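/- Let w ∈ P_p(T) on a shape-regular triangle T of diameter h_l. Then ‖w‖_{0,T} ≤ C ( h_l · sup_{v ∈ (P_p(T))², v≠0} |∫_T w div v| / ‖v‖_{0,T} + h_l^{1/2} ‖w‖_{0,∂T} ), with C depending only on p and shape regularity. (This follows by mapping to the reference triangle, using the divergence-conserving transform, norm equivalence on the finite-dimensional space P_p(T̂), and scaling: ‖w‖_{0,T} ≈ h_l ‖ŵ‖_{0,T̂} and ‖w‖_{0,∂T} ≈ h_l^{1/2} ‖ŵ‖_{0,∂T̂}.) -/

import Mathlib

open MeasureTheory MvPolynomial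

noncomputable section

/-- The reference triangle `T̂ ⊂ ℝ²`. -/
def Tref : Set (Fin 2 → ℝ) := {x | 0 ≤ x 0 ∧ 0 ≤ x 1 ∧ x 0 + x 1 ≤ 1}

/-- Divergence of a polynomial vector field. -/
def divP (v : Fin 2 → MvPolynomial (Fin 2) ℝ) : MvPolynomial (Fin 2) ℝ :=
  pderiv 0 (v 0) + pderiv 1 (v 1)

/-- Squared weighted line integral of `w²` along the segment from `A` to `A'`
(the arc-length factor `‖A' − A‖` gives the correct `L²`-scaling of an edge). -/
def edgeSq (w : MvPolynomial (Fin 2) ℝ) (A A' : Fin 2 → ℝ) : ℝ :=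
  ‖A' - A‖ * ∫ t in (0:ℝ)..1, (eval ((1 - t) • A + t • A') w) ^ 2

/-- Homogeneous quadratic comparison on `Fin n → ℝ`. -/
lemma quad_cmp_pi {n : ℕ} (f g : (Fin n → ℝ) → ℝ) (hf : Continuous f) (hg : Continuous g)
    (hfh : ∀ (c : ℝ) x, f (c • x) = c ^ 2 * f x) (hgh : ∀ (c : ℝ) x, g (c • x) = c ^ 2 * g x)
    (hpos : ∀ x, x ≠ 0 → 0 < g x) : ∃ K > 0, ∀ x, f x ≤ K * g x := by
  have hcomp : IsCompact (Metric.sphere (0 : Fin n → ℝ) 1) := isCompact_sphere _ _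
  have hcont : ContinuousOn (fun x => f x / g x) (Metric.sphere (0 : Fin n → ℝ) 1) := by
    apply ContinuousOn.div hf.continuousOn hg.continuousOn
    intro x hx
    have : x ≠ 0 := by
      rintro rfl
      simp at hx
    exact (hpos x this).ne'
  obtain ⟨K, hK⟩ := hcomp.bddAbove_image hcont
  refine ⟨max K 1, by positivity, fun x => ?_⟩
  by_cases hx : x = 0
  · have h1 := hfh 0 0
    have h2 := hgh 0 0
    simp at h1 h2
    simp [hx, h1, h2]
  · have hn : 0 < ‖x‖ := norm_pos_iff.mpr hx
    have hmem : (‖x‖⁻¹ • x) ∈ Metric.sphere (0 : Fin n → ℝ) 1 := by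
      simp [norm_smul, hn.ne']
    have h1 := hK ⟨_, hmem, rfl⟩
    simp only [hfh, hgh] at h1
    have hne : (‖x‖⁻¹) ^ 2 ≠ 0 := by positivity
    rw [mul_div_mul_left _ _ hne, div_le_iff₀ (hpos x hx)] at h1
    exact h1.trans (mul_le_mul_of_nonneg_right (le_max_left _ _) (hpos x hx).le)

/-- Comparison of quadratic forms on a finite-dimensional space. -/
lemma quad_cmp {V : Type*} [AddCommGroup V] [Module ℝ V] [Module.Finite ℝ V]
    (f g : V →ₗ[ℝ] V →ₗ[ℝ] ℝ) (hg0 : ∀ x, 0 ≤ g x x) (hg : ∀ x, g x x = 0 → x = 0) :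
    ∃ K > 0, ∀ x, f x x ≤ K * g x x := by
  let b := Module.finBasis ℝ V
  have key : ∀ h : V →ₗ[ℝ] V →ₗ[ℝ] ℝ, Continuous
      (fun c : Fin (Module.finrank ℝ V) → ℝ => h (b.equivFun.symm c) (b.equivFun.symm c)) := by
    intro h
    simp only [Module.Basis.equivFun_symm_apply, map_sum, LinearMap.sum_apply, map_smul,
      LinearMap.smul_apply, smul_eq_mul]
    fun_prop
  obtain ⟨K, hK, h⟩ := quad_cmp_pi _ _ (key f) (key g)
    (by intro c x; simp only [map_smul, LinearMap.smul_apply, smul_eq_mul]; ring)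
    (by intro c x; simp only [map_smul, LinearMap.smul_apply, smul_eq_mul]; ring)
    (by
      intro x hx
      refine lt_of_le_of_ne (hg0 _) (fun h0 => hx ?_)
      exact b.equivFun.symm.map_eq_zero_iff.mp (hg _ h0.symm))
  refine ⟨K, hK, fun x => ?_⟩
  simpa using h (b.equivFun x)

lemma continuous_evalP (q : MvPolynomial (Fin 2) ℝ) : Continuous fun x => eval x q :=
  MvPolynomial.continuous_eval q

/-- `L²` product of two polynomials along a map. -/
def bilP {X : Type*} [TopologicalSpace X] [MeasurableSpace X] [T2Space X] [OpensMeasurableSpace X]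
    (μ : Measure X) [IsFiniteMeasureOnCompacts μ]
    (K : Set X) (hK : IsCompact K) (φ : X → Fin 2 → ℝ) (hφ : Continuous φ) :
    MvPolynomial (Fin 2) ℝ →ₗ[ℝ] MvPolynomial (Fin 2) ℝ →ₗ[ℝ] ℝ :=
  LinearMap.mk₂ ℝ (fun u v => ∫ x in K, eval (φ x) u * eval (φ x) v ∂μ)
    (by
      intro u u' v
      rw [← integral_add]
      · simp [add_mul]
      all_goals
        exact (((continuous_evalP _).comp hφ).mul
          ((continuous_evalP _).comp hφ)).continuousOn.integrableOn_compact hK)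
    (by
      intro c u v
      simp only [smul_eval, smul_eq_mul, mul_assoc]
      rw [integral_const_mul])
    (by
      intro u u' v
      rw [← integral_add]
      · simp [mul_add]
      all_goals
        exact (((continuous_evalP _).comp hφ).mul
          ((continuous_evalP _).comp hφ)).continuousOn.integrableOn_compact hK)
    (by
      intro c u v
      simp only [smul_eval, smul_eq_mul]
      rw [← integral_const_mul]
      congr 1
      ext x
      ring)

lemma isCompact_Tref : IsCompact Tref := by
  apply Metric.isCompact_of_isClosed_isBounded
  · have : Tref = {x | 0 ≤ x 0} ∩ ({x | 0 ≤ x 1} ∩ {x | x 0 + x 1 ≤ 1}) := by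
      ext x; simp [Tref]
    rw [this]
    exact (isClosed_le (by fun_prop) (by fun_prop)).inter
      ((isClosed_le (by fun_prop) (by fun_prop)).inter (isClosed_le (by fun_prop) (by fun_prop)))
  · refine (Metric.isBounded_Icc (0 : Fin 2 → ℝ) 1).subset ?_
    rintro x ⟨h0, h1, h2⟩
    constructor <;> intro i <;> fin_cases i <;> simp <;> linarith

lemma int_cont {f : (Fin 2 → ℝ) → ℝ} (hf : Continuous f) : IntegrableOn f Tref :=
  hf.continuousOn.integrableOn_compact isCompact_Tref

lemma eq_zero_of_int_sq (q : MvPolynomial (Fin 2) ℝ)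
    (h : ∫ x in Tref, (eval x q) ^ 2 = 0) : q = 0 := by
  have hc : Continuous fun x => (eval x q) ^ 2 := (continuous_evalP q).pow 2
  rw [setIntegral_eq_zero_iff_of_nonneg_ae (Filter.Eventually.of_forall fun x => sq_nonneg _)
    (int_cont hc)] at h
  let s : Fin 2 → Set ℝ := fun _ => Set.Ioo 0 (1/2)
  have hopen : IsOpen (Set.pi Set.univ s) :=
    isOpen_set_pi Set.finite_univ (fun _ _ => isOpen_Ioo)
  have hsub : Set.pi Set.univ s ⊆ Tref := by
    intro x hx
    have h0 := hx 0 trivial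
    have h1 := hx 1 trivial
    simp only [s, Set.mem_Ioo] at h0 h1
    exact ⟨h0.1.le, h1.1.le, by linarith⟩
  have h2 := Measure.eqOn_open_of_ae_eq (ae_restrict_of_ae_restrict_of_subset hsub h) hopen
    hc.continuousOn continuousOn_const
  apply MvPolynomial.funext_set s (fun _ => Set.Ioo_infinite (by norm_num))
  intro x hx
  have := h2 hx
  simpa using this

lemma totalDegree_pderiv_le' (i : Fin 2) (q : MvPolynomial (Fin 2) ℝ) :
    (pderiv i q).totalDegree ≤ q.totalDegree := by
  conv_lhs => rw [q.as_sum]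
  rw [map_sum]
  refine (totalDegree_finsetSum _ _).trans (Finset.sup_le fun m hm => ?_)
  rw [pderiv_monomial]
  refine (totalDegree_monomial_le _ _).trans ?_
  refine le_trans ?_ (le_totalDegree hm)
  exact Finsupp.sum_le_sum_index (by exact tsub_le_self) (fun _ _ => monotone_id) (by simp)

/-- derivative of a polynomial in the first variable -/
lemma hasDerivAt_x (q : MvPolynomial (Fin 2) ℝ) (x y : ℝ) :
    HasDerivAt (fun s => eval ![s, y] q) (eval ![x, y] (pderiv 0 q)) x := by
  induction q using MvPolynomial.induction_on with
  | C a => simpa using hasDerivAt_const x a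
  | add p q hp hq => simpa using hp.fun_add hq
  | mul_X p i hp =>
    simp only [map_mul, eval_X, Derivation.leibniz, smul_eq_mul, map_add]
    fin_cases i
    · have := hp.fun_mul (hasDerivAt_id' x)
      simpa [pderiv_X, mul_comm, add_comm] using this
    · have := hp.mul_const y
      simpa [pderiv_X, mul_comm] using this

lemma int_pderiv_zero (q : MvPolynomial (Fin 2) ℝ)
    (h0 : ∀ y ∈ Set.Icc (0:ℝ) 1, eval ![0, y] q = 0)
    (h1 : ∀ y ∈ Set.Icc (0:ℝ) 1, eval ![1 - y, y] q = 0) :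
    ∫ x in Tref, eval x (pderiv 0 q) = 0 := by
  have hm : MeasurableSet Tref := isCompact_Tref.measurableSet
  rw [← integral_indicator hm]
  have hint : Integrable (Tref.indicator fun x => eval x (pderiv 0 q)) :=
    (integrable_indicator_iff hm).mpr (int_cont (continuous_evalP _))
  have mp := (volume_preserving_finTwoArrow ℝ).symm
  rw [← mp.integral_comp (MeasurableEquiv.measurableEmbedding _)]
  have hint2 := (mp.integrable_comp_emb (MeasurableEquiv.measurableEmbedding _)).mpr hint
  rw [Measure.volume_eq_prod] at hint2 ⊢
  simp only [Function.comp_def] at hint2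
  rw [integral_prod_symm _ hint2]
  apply integral_eq_zero_of_ae
  refine Filter.Eventually.of_forall fun y => ?_
  simp only [Pi.zero_apply]
  have he : ∀ x : ℝ, MeasurableEquiv.finTwoArrow.symm (x, y) = ![x, y] := fun x => rfl
  simp only [he]
  by_cases hy : y ∈ Set.Icc (0:ℝ) 1
  · have : (fun x : ℝ => Tref.indicator (fun x => eval x (pderiv 0 q)) ![x, y]) =
        (Set.Icc 0 (1 - y)).indicator (fun x => eval ![x, y] (pderiv 0 q)) := by
      ext x
      simp only [Set.indicator]
      congr 1
      simp only [Tref, Set.mem_ofPred_eq, Set.mem_Icc, eq_iff_iff]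
      simp
      intro _
      constructor
      · rintro ⟨_, h⟩; linarith
      · intro h; exact ⟨hy.1, by linarith⟩
    rw [this, integral_indicator measurableSet_Icc, integral_Icc_eq_integral_Ioc,
      ← intervalIntegral.integral_of_le (by linarith [hy.2])]
    rw [intervalIntegral.integral_eq_sub_of_hasDerivAt (fun x _ => hasDerivAt_x q x y)]
    · rw [h0 y hy, h1 y hy]; simp
    · apply Continuous.intervalIntegrable
      exact (continuous_evalP _).comp (by fun_prop)
  · have : (fun x : ℝ => Tref.indicator (fun x => eval x (pderiv 0 q)) ![x, y]) = fun _ => 0 := by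
      ext x
      apply Set.indicator_of_notMem
      rintro ⟨a, b, c⟩
      simp at a b c
      exact hy ⟨b, by linarith⟩
    rw [this]; simp

lemma edge_zero {h : ℝ → ℝ} (hc : Continuous h) (h0 : ∫ t in (0:ℝ)..1, (h t) ^ 2 = 0) :
    ∀ t ∈ Set.Icc (0:ℝ) 1, h t = 0 := by
  rw [intervalIntegral.integral_of_le zero_le_one, ← integral_Icc_eq_integral_Ioc] at h0
  have hc2 : Continuous fun t => (h t) ^ 2 := hc.pow 2
  rw [setIntegral_eq_zero_iff_of_nonneg_ae (Filter.Eventually.of_forall fun x => sq_nonneg _)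
    (hc2.continuousOn.integrableOn_compact isCompact_Icc)] at h0
  have := Measure.eqOn_Icc_of_ae_eq volume zero_ne_one h0 hc2.continuousOn continuousOn_const
  intro t ht
  have := this ht
  simpa using this

/-- Edge integral along a segment (unweighted). -/
def edgeI (w : MvPolynomial (Fin 2) ℝ) (A A' : Fin 2 → ℝ) : ℝ :=
  ∫ t in (0:ℝ)..1, (eval ((1 - t) • A + t • A') w) ^ 2

lemma edgeI_nonneg (w : MvPolynomial (Fin 2) ℝ) (A A' : Fin 2 → ℝ) : 0 ≤ edgeI w A A' :=
  intervalIntegral.integral_nonneg zero_le_one fun _ _ => sq_nonneg _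

/-- Bilinear form of an edge. -/
def edgeB (A A' : Fin 2 → ℝ) :
    MvPolynomial (Fin 2) ℝ →ₗ[ℝ] MvPolynomial (Fin 2) ℝ →ₗ[ℝ] ℝ :=
  bilP (volume : Measure ℝ) (Set.Icc 0 1) isCompact_Icc (fun t => (1 - t) • A + t • A')
    (by fun_prop)

lemma edgeB_apply (A A' : Fin 2 → ℝ) (w) : edgeB A A' w w = edgeI w A A' := by
  simp only [edgeB, bilP, LinearMap.mk₂_apply, edgeI]
  rw [intervalIntegral.integral_of_le zero_le_one, ← integral_Icc_eq_integral_Ioc]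
  simp only [pow_two]

/-- `L²` form on the reference triangle. -/
def trefB : MvPolynomial (Fin 2) ℝ →ₗ[ℝ] MvPolynomial (Fin 2) ℝ →ₗ[ℝ] ℝ :=
  bilP (volume : Measure (Fin 2 → ℝ)) Tref isCompact_Tref id continuous_id

lemma trefB_apply (u v) : trefB u v = ∫ x in Tref, eval x u * eval x v := rfl

lemma trefB_self (u) : trefB u u = ∫ x in Tref, (eval x u) ^ 2 := by
  simp only [trefB_apply, pow_two]

lemma trefB_nonneg (u) : 0 ≤ trefB u u := by
  rw [trefB_self]; exact integral_nonneg fun _ => sq_nonneg _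

lemma ref_def (w : MvPolynomial (Fin 2) ℝ)
    (hE1 : edgeI w (Pi.single 0 1) (Pi.single 1 1) = 0) (hE2 : edgeI w (Pi.single 1 1) 0 = 0)
    (hw : trefB w (pderiv 0 (pderiv 0 w)) = 0) : w = 0 := by
  have h1 : ∀ y ∈ Set.Icc (0:ℝ) 1, eval ![1 - y, y] w = 0 := by
    intro y hy
    have := edge_zero ((continuous_evalP w).comp (by fun_prop)) hE1 y hy
    have hv : (1 - y) • (Pi.single 0 1 : Fin 2 → ℝ) + y • Pi.single 1 1 = ![1 - y, y] := by
      ext i; fin_cases i <;> simp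
    rw [← hv]; exact this
  have h0 : ∀ y ∈ Set.Icc (0:ℝ) 1, eval ![0, y] w = 0 := by
    intro y hy
    have := edge_zero ((continuous_evalP w).comp (by fun_prop)) hE2 (1 - y)
      ⟨by linarith [hy.2], by linarith [hy.1]⟩
    have hv : (1 - (1 - y)) • (Pi.single 1 1 : Fin 2 → ℝ) + (1 - y) • 0 = ![0, y] := by
      ext i; fin_cases i <;> simp
    rw [← hv]; exact this
  have h2 := int_pderiv_zero (w * pderiv 0 w) (fun y hy => by simp [h0 y hy])
    (fun y hy => by simp [h1 y hy])
  have h3 : ∫ x in Tref, (eval x (pderiv 0 w)) ^ 2 = 0 := by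
    have : ∫ x in Tref, eval x (pderiv 0 (w * pderiv 0 w)) =
        trefB w (pderiv 0 (pderiv 0 w)) + trefB (pderiv 0 w) (pderiv 0 w) := by
      rw [trefB_apply, trefB_apply, ← integral_add]
      · simp [Derivation.leibniz]
      all_goals exact int_cont ((continuous_evalP _).mul (continuous_evalP _))
    rw [h2, hw, zero_add, trefB_self] at this
    exact this.symm
  have h4 := eq_zero_of_int_sq _ h3
  apply eq_zero_of_int_sq
  rw [setIntegral_congr_fun (g := fun _ => (0:ℝ)) isCompact_Tref.measurableSet]
  · simp
  rintro x ⟨a, b, c⟩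
  have hconst : eval ![x 0, x 1] w = eval ![0, x 1] w := by
    refine is_const_of_deriv_eq_zero (f := fun s => eval ![s, x 1] w)
      (fun s => (hasDerivAt_x w s _).differentiableAt) (fun s => ?_) _ _
    rw [(hasDerivAt_x w s _).deriv, h4]; simp
  have hx : x = ![x 0, x 1] := by ext i; fin_cases i <;> rfl
  simp only
  rw [hx, hconst, h0 (x 1) ⟨b, by linarith⟩]
  simp

lemma ref_est (p : ℕ) : ∃ (n : ℕ) (u : Fin n → MvPolynomial (Fin 2) ℝ) (K : ℝ), 0 < K ∧
    (∀ i, (u i).totalDegree ≤ p) ∧ ∀ w : MvPolynomial (Fin 2) ℝ, w.totalDegree ≤ p →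
      trefB w w ≤ K * (∑ i, (trefB w (pderiv 0 (u i))) ^ 2 +
        (edgeI w (Pi.single 0 1) (Pi.single 1 1) + edgeI w (Pi.single 1 1) 0)) := by
  let V := restrictTotalDegree (Fin 2) ℝ p
  let b := Module.finBasis ℝ V
  let ℓ : Fin (Module.finrank ℝ V) → V →ₗ[ℝ] ℝ := fun i =>
    (trefB.flip (pderiv 0 (b i : MvPolynomial (Fin 2) ℝ))) ∘ₗ V.subtype
  let f : V →ₗ[ℝ] V →ₗ[ℝ] ℝ := trefB.compl₁₂ V.subtype V.subtype
  let g : V →ₗ[ℝ] V →ₗ[ℝ] ℝ := ∑ i, (LinearMap.mul ℝ ℝ).compl₁₂ (ℓ i) (ℓ i) +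
    ((edgeB (Pi.single 0 1) (Pi.single 1 1)).compl₁₂ V.subtype V.subtype +
      (edgeB (Pi.single 1 1) 0).compl₁₂ V.subtype V.subtype)
  have hgapp : ∀ w : V, g w w = ∑ i, (trefB w (pderiv 0 (b i : MvPolynomial (Fin 2) ℝ))) ^ 2 +
        (edgeI w (Pi.single 0 1) (Pi.single 1 1) + edgeI w (Pi.single 1 1) 0) := by
    intro w
    simp [g, ℓ, LinearMap.sum_apply, edgeB_apply, pow_two]
  have hs : ∀ w : V, 0 ≤ ∑ i, (trefB w (pderiv 0 (b i : MvPolynomial (Fin 2) ℝ))) ^ 2 :=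
    fun w => Finset.sum_nonneg fun i _ => sq_nonneg _
  obtain ⟨K, hK, h⟩ := quad_cmp f g
    (by
      intro w
      rw [hgapp]
      have := hs w
      have := edgeI_nonneg w (Pi.single 0 1) (Pi.single 1 1)
      have := edgeI_nonneg w (Pi.single 1 1) 0
      positivity)
    (by
      intro w hw
      rw [hgapp] at hw
      have a1 := hs w
      have a2 := edgeI_nonneg w (Pi.single 0 1) (Pi.single 1 1)
      have a3 := edgeI_nonneg w (Pi.single 1 1) 0
      have e1 : ∑ i, (trefB w (pderiv 0 (b i : MvPolynomial (Fin 2) ℝ))) ^ 2 = 0 := by linarith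
      rw [Finset.sum_eq_zero_iff_of_nonneg (fun i _ => sq_nonneg _)] at e1
      have e2 : (trefB w ∘ₗ (pderiv 0 : Derivation ℝ (MvPolynomial (Fin 2) ℝ)
          (MvPolynomial (Fin 2) ℝ)).toLinearMap ∘ₗ V.subtype) = 0 := by
        apply b.ext
        intro i
        have := e1 i (Finset.mem_univ _)
        simpa using this
      have hd : pderiv 0 (w : MvPolynomial (Fin 2) ℝ) ∈ V := by
        rw [mem_restrictTotalDegree]
        exact (totalDegree_pderiv_le' _ _).trans ((mem_restrictTotalDegree _ _ _).mp w.2)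
      have e3 := LinearMap.congr_fun e2 ⟨_, hd⟩
      apply Subtype.ext
      exact ref_def w (by linarith) (by linarith) (by simpa using e3))
  refine ⟨_, fun i => b i, K, hK, fun i => (mem_restrictTotalDegree _ _ _).mp (b i).2, ?_⟩
  intro w hw
  have := h ⟨w, (mem_restrictTotalDegree _ _ _).mpr hw⟩
  rw [hgapp] at this
  exact this

/-- Composition of a polynomial with an affine map. -/
def aff (B : Matrix (Fin 2) (Fin 2) ℝ) (b : Fin 2 → ℝ) :
    MvPolynomial (Fin 2) ℝ →ₐ[ℝ] MvPolynomial (Fin 2) ℝ :=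
  aeval fun i => C (B i 0) * X 0 + C (B i 1) * X 1 + C (b i)

lemma eval_aff (B : Matrix (Fin 2) (Fin 2) ℝ) (b y : Fin 2 → ℝ) (q : MvPolynomial (Fin 2) ℝ) :
    eval y (aff B b q) = eval (B.mulVec y + b) q := by
  induction q using MvPolynomial.induction_on with
  | C a => simp [aff]
  | add p q hp hq => simp [hp, hq]
  | mul_X p i hp =>
    have hX : eval y (aff B b (X i)) = (B.mulVec y + b) i := by
      rw [Pi.add_apply, Matrix.mulVec, dotProduct, Fin.sum_univ_two]
      simp [aff]
    rw [map_mul, map_mul, hp, map_mul, hX, eval_X]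

lemma pderiv_aff (B : Matrix (Fin 2) (Fin 2) ℝ) (b : Fin 2 → ℝ) (j : Fin 2)
    (q : MvPolynomial (Fin 2) ℝ) :
    pderiv j (aff B b q) = C (B 0 j) * aff B b (pderiv 0 q) + C (B 1 j) * aff B b (pderiv 1 q) := by
  induction q using MvPolynomial.induction_on with
  | C a => simp [aff]
  | add p q hp hq => simp only [map_add, hp, hq]; ring
  | mul_X p i hp =>
    have hX : aff B b (X i) = C (B i 0) * X 0 + C (B i 1) * X 1 + C (b i) := by simp [aff]
    have hdX : pderiv j (aff B b (X i)) = C (B i j) := by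
      rw [hX]
      fin_cases j <;> simp [Derivation.leibniz, pderiv_X]
    rw [map_mul, Derivation.leibniz, hp, hdX]
    simp only [Derivation.leibniz, smul_eq_mul, map_add, map_mul]
    fin_cases i <;> simp [pderiv_X] <;> ring

lemma totalDegree_aff_le (B : Matrix (Fin 2) (Fin 2) ℝ) (b : Fin 2 → ℝ)
    (q : MvPolynomial (Fin 2) ℝ) : (aff B b q).totalDegree ≤ q.totalDegree := by
  have hlin : ∀ i, (C (B i 0) * X 0 + C (B i 1) * X 1 + C (b i) :
      MvPolynomial (Fin 2) ℝ).totalDegree ≤ 1 := by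
    intro i
    refine (totalDegree_add _ _).trans (max_le ((totalDegree_add _ _).trans (max_le ?_ ?_)) ?_)
    · refine (totalDegree_mul _ _).trans ?_
      simp
    · refine (totalDegree_mul _ _).trans ?_
      simp
    · simp
  conv_lhs => rw [q.as_sum]
  rw [map_sum]
  refine (totalDegree_finsetSum _ _).trans (Finset.sup_le fun m hm => ?_)
  refine le_trans ?_ (le_totalDegree hm)
  rw [aff, aeval_monomial]
  refine (totalDegree_mul _ _).trans ?_
  simp only [algebraMap_eq, totalDegree_C, zero_add]
  refine (totalDegree_finsetProd _ _).trans ?_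
  refine Finset.sum_le_sum fun i _ => ?_
  refine (totalDegree_pow _ _).trans ?_
  simpa using Nat.mul_le_mul_left (m i) (hlin i)

lemma aff_inv (B : Matrix (Fin 2) (Fin 2) ℝ) (b : Fin 2 → ℝ) (hB : IsUnit B.det)
    (q : MvPolynomial (Fin 2) ℝ) : aff B b (aff B⁻¹ (-(B⁻¹.mulVec b)) q) = q := by
  apply MvPolynomial.funext
  intro x
  rw [eval_aff, eval_aff]
  congr 2
  rw [Matrix.mulVec_add, Matrix.mulVec_mulVec, Matrix.nonsing_inv_mul _ hB, Matrix.one_mulVec,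
    add_neg_cancel_right]

lemma aff_injective (B : Matrix (Fin 2) (Fin 2) ℝ) (b : Fin 2 → ℝ) (hB : IsUnit B.det)
    (q : MvPolynomial (Fin 2) ℝ) (h : aff B b q = 0) : q = 0 := by
  apply MvPolynomial.funext
  intro x
  have : x = B.mulVec (B⁻¹.mulVec (x - b)) + b := by
    rw [Matrix.mulVec_mulVec, Matrix.mul_nonsing_inv _ hB]
    simp
  rw [this, ← eval_aff, h]
  simp

lemma int_image (B : Matrix (Fin 2) (Fin 2) ℝ) (b : Fin 2 → ℝ) (hB : IsUnit B.det)
    (g : (Fin 2 → ℝ) → ℝ) :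
    ∫ x in (fun y => B.mulVec y + b) '' Tref, g x = |B.det| * ∫ y in Tref, g (B.mulVec y + b) := by
  have hd : ∀ x ∈ Tref, HasFDerivWithinAt (fun y => B.mulVec y + b)
      (LinearMap.toContinuousLinearMap (Matrix.toLin' B)) Tref x := by
    intro x _
    have := (LinearMap.toContinuousLinearMap (Matrix.toLin' B)).hasFDerivWithinAt (s := Tref) (x := x)
    exact this.add_const b
  have hinj : Set.InjOn (fun y => B.mulVec y + b) Tref := by
    intro x _ y _ h
    have h' : B.mulVec x = B.mulVec y := by simpa using h
    exact Matrix.mulVec_injective_iff_isUnit.mpr ((Matrix.isUnit_iff_isUnit_det B).mpr hB) h'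
  rw [integral_image_eq_integral_abs_det_fderiv_smul volume isCompact_Tref.measurableSet hd hinj]
  simp only [smul_eq_mul]
  rw [integral_const_mul]
  simp [ContinuousLinearMap.det, LinearMap.det_toLin']

lemma bdd_one (p : ℕ) (B : Matrix (Fin 2) (Fin 2) ℝ) (b : Fin 2 → ℝ) (hB : IsUnit B.det)
    (W : MvPolynomial (Fin 2) ℝ) (i : Fin 2) : ∃ K > 0, ∀ u : MvPolynomial (Fin 2) ℝ,
      u.totalDegree ≤ p → (trefB W (aff B b (pderiv i u))) ^ 2 ≤
        K * trefB (aff B b u) (aff B b u) := by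
  let V := restrictTotalDegree (Fin 2) ℝ p
  let ℓ : V →ₗ[ℝ] ℝ := trefB W ∘ₗ (aff B b).toLinearMap ∘ₗ
    (pderiv i : Derivation ℝ (MvPolynomial (Fin 2) ℝ) (MvPolynomial (Fin 2) ℝ)).toLinearMap ∘ₗ
    V.subtype
  let m : V →ₗ[ℝ] MvPolynomial (Fin 2) ℝ := (aff B b).toLinearMap ∘ₗ V.subtype
  obtain ⟨K, hK, h⟩ := quad_cmp ((LinearMap.mul ℝ ℝ).compl₁₂ ℓ ℓ) (trefB.compl₁₂ m m)
    (fun u => trefB_nonneg _)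
    (fun u hu => by
      apply Subtype.ext
      apply aff_injective B b hB
      apply eq_zero_of_int_sq
      rw [← trefB_self]
      exact hu)
  refine ⟨K, hK, fun u hu => ?_⟩
  have := h ⟨u, (mem_restrictTotalDegree _ _ _).mpr hu⟩
  rw [pow_two]
  exact this

lemma int_D (B : Matrix (Fin 2) (Fin 2) ℝ) (b : Fin 2 → ℝ) (hB : IsUnit B.det)
    (w q : MvPolynomial (Fin 2) ℝ) :
    ∫ x in (fun y => B.mulVec y + b) '' Tref, eval x w * eval x q =
      |B.det| * trefB (aff B b w) (aff B b q) := by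
  rw [int_image B b hB, trefB_apply]
  simp only [eval_aff]

lemma int_S (B : Matrix (Fin 2) (Fin 2) ℝ) (b : Fin 2 → ℝ) (hB : IsUnit B.det)
    (w : MvPolynomial (Fin 2) ℝ) :
    ∫ x in (fun y => B.mulVec y + b) '' Tref, (eval x w) ^ 2 =
      |B.det| * trefB (aff B b w) (aff B b w) := by
  rw [← int_D B b hB]
  simp only [pow_two]

lemma int_N (B : Matrix (Fin 2) (Fin 2) ℝ) (b : Fin 2 → ℝ) (hB : IsUnit B.det)
    (u v : MvPolynomial (Fin 2) ℝ) :
    ∫ x in (fun y => B.mulVec y + b) '' Tref, ((eval x u) ^ 2 + (eval x v) ^ 2) =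
      |B.det| * (trefB (aff B b u) (aff B b u) + trefB (aff B b v) (aff B b v)) := by
  rw [int_image B b hB, trefB_self, trefB_self, ← integral_add]
  · simp only [eval_aff]
  all_goals exact int_cont ((continuous_evalP _).pow 2)

/-- The supremum bound, on the physical triangle. -/
lemma sup_bound (p : ℕ) (B : Matrix (Fin 2) (Fin 2) ℝ) (b : Fin 2 → ℝ) (hB : IsUnit B.det)
    (w : MvPolynomial (Fin 2) ℝ) (S : ℝ)
    (hS : S = sSup {r : ℝ | ∃ v : Fin 2 → MvPolynomial (Fin 2) ℝ,
              (∀ i, (v i).totalDegree ≤ p) ∧ v ≠ 0 ∧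
              r = |∫ x in (fun y => B.mulVec y + b) '' Tref,
                    eval x w * eval x (divP v)| /
                Real.sqrt (∫ x in (fun y => B.mulVec y + b) '' Tref,
                    ((eval x (v 0)) ^ 2 + (eval x (v 1)) ^ 2))}) :
    0 ≤ S ∧ ∀ v : Fin 2 → MvPolynomial (Fin 2) ℝ, (∀ i, (v i).totalDegree ≤ p) →
      |B.det| * (trefB (aff B b w) (aff B b (divP v))) ^ 2 ≤ S ^ 2 *
        (trefB (aff B b (v 0)) (aff B b (v 0)) + trefB (aff B b (v 1)) (aff B b (v 1))) := by
  have hd : 0 < |B.det| := abs_pos.mpr hB.ne_zero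
  have hS0 : 0 ≤ S := by
    rw [hS]
    apply Real.sSup_nonneg
    rintro r ⟨v, -, -, rfl⟩
    positivity
  refine ⟨hS0, ?_⟩
  obtain ⟨K0, hK0, hb0⟩ := bdd_one p B b hB (aff B b w) 0
  obtain ⟨K1, hK1, hb1⟩ := bdd_one p B b hB (aff B b w) 1
  have hbd : ∀ v : Fin 2 → MvPolynomial (Fin 2) ℝ, (∀ i, (v i).totalDegree ≤ p) →
      (trefB (aff B b w) (aff B b (divP v))) ^ 2 ≤ (2 * (K0 + K1)) *
        (trefB (aff B b (v 0)) (aff B b (v 0)) + trefB (aff B b (v 1)) (aff B b (v 1))) := by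
    intro v hv
    have h0 := hb0 (v 0) (hv 0)
    have h1 := hb1 (v 1) (hv 1)
    have n0 := trefB_nonneg (aff B b (v 0))
    have n1 := trefB_nonneg (aff B b (v 1))
    rw [divP, map_add, map_add]
    nlinarith [sq_nonneg (trefB (aff B b w) (aff B b (pderiv 0 (v 0))) -
      trefB (aff B b w) (aff B b (pderiv 1 (v 1)))), mul_nonneg hK0.le n1, mul_nonneg hK1.le n0]
  have hbdd : BddAbove {r : ℝ | ∃ v : Fin 2 → MvPolynomial (Fin 2) ℝ,
              (∀ i, (v i).totalDegree ≤ p) ∧ v ≠ 0 ∧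
              r = |∫ x in (fun y => B.mulVec y + b) '' Tref,
                    eval x w * eval x (divP v)| /
                Real.sqrt (∫ x in (fun y => B.mulVec y + b) '' Tref,
                    ((eval x (v 0)) ^ 2 + (eval x (v 1)) ^ 2))} := by
    refine ⟨Real.sqrt (|B.det| * (2 * (K0 + K1))), ?_⟩
    rintro r ⟨v, hv, -, rfl⟩
    rw [int_D B b hB, int_N B b hB]
    have n0 := trefB_nonneg (aff B b (v 0))
    have n1 := trefB_nonneg (aff B b (v 1))
    refine div_le_of_le_mul₀ (Real.sqrt_nonneg _) (Real.sqrt_nonneg _) ?_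
    rw [← Real.sqrt_mul (by positivity)]
    apply Real.abs_le_sqrt
    have := mul_le_mul_of_nonneg_left (hbd v hv) (sq_nonneg (|B.det|))
    linarith
  intro v hv
  have n0 := trefB_nonneg (aff B b (v 0))
  have n1 := trefB_nonneg (aff B b (v 1))
  by_cases hv0 : v = 0
  · subst hv0
    simp [divP]
  set N := trefB (aff B b (v 0)) (aff B b (v 0)) + trefB (aff B b (v 1)) (aff B b (v 1)) with hN
  rcases (add_nonneg n0 n1).eq_or_lt with hz | hz
  · have := hbd v hv
    rw [← hN, hN, ← hz, mul_zero] at this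
    have h2 := le_antisymm this (sq_nonneg _)
    rw [h2, mul_zero]
    positivity
  · have hle := le_csSup hbdd ⟨v, hv, hv0, rfl⟩
    rw [← hS, int_D B b hB, int_N B b hB, ← hN,
      div_le_iff₀ (Real.sqrt_pos.mpr (mul_pos hd hz))] at hle
    have hsq := pow_le_pow_left₀ (abs_nonneg _) hle 2
    rw [sq_abs, mul_pow, mul_pow, Real.sq_sqrt (mul_pos hd hz).le] at hsq
    have : |B.det| * (|B.det| * (trefB (aff B b w) (aff B b (divP v))) ^ 2) ≤
        |B.det| * (S ^ 2 * N) := by linarith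
    exact le_of_mul_le_mul_left this hd

lemma edge_low (B : Matrix (Fin 2) (Fin 2) ℝ) (b : Fin 2 → ℝ) (hl ρ : ℝ) (hρ : 0 < ρ) (hl0 : 0 < hl)
    (h2 : ∀ x : Fin 2 → ℝ, ‖x‖ ≤ (ρ / hl) * ‖B.mulVec x‖) (w : MvPolynomial (Fin 2) ℝ)
    (a a' : Fin 2 → ℝ) (ha : 1 ≤ ‖a' - a‖) :
    hl * edgeI (aff B b w) a a' ≤ ρ * edgeSq w (B.mulVec a + b) (B.mulVec a' + b) := by
  have he : edgeI (aff B b w) a a' = ∫ t in (0:ℝ)..1,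
      (eval ((1 - t) • (B.mulVec a + b) + t • (B.mulVec a' + b)) w) ^ 2 := by
    unfold edgeI
    congr 1
    ext t
    rw [eval_aff]
    congr 3
    rw [Matrix.mulVec_add, Matrix.mulVec_smul, Matrix.mulVec_smul]
    module
  have hn : hl ≤ ρ * ‖(B.mulVec a' + b) - (B.mulVec a + b)‖ := by
    have := ha.trans (h2 (a' - a))
    rw [Matrix.mulVec_sub] at this
    rw [add_sub_add_right_eq_sub]
    rw [div_mul_eq_mul_div, le_div_iff₀ hl0] at this
    linarith
  unfold edgeSq
  rw [← he, ← mul_assoc]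
  exact mul_le_mul_of_nonneg_right hn (edgeI_nonneg _ _ _)

lemma entry_le (B : Matrix (Fin 2) (Fin 2) ℝ) (hl : ℝ)
    (h1 : ∀ x : Fin 2 → ℝ, ‖B.mulVec x‖ ≤ hl * ‖x‖) (i j : Fin 2) : |B i j| ≤ hl := by
  have := (norm_le_pi_norm (B.mulVec (Pi.single j 1)) i).trans (h1 _)
  simpa [Pi.norm_single] using this

lemma main_est (p : ℕ) (n : ℕ) (u : Fin n → MvPolynomial (Fin 2) ℝ)
    (hu : ∀ i, (u i).totalDegree ≤ p) (B : Matrix (Fin 2) (Fin 2) ℝ) (b : Fin 2 → ℝ)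
    (hB : IsUnit B.det) (hl : ℝ) (h1 : ∀ x : Fin 2 → ℝ, ‖B.mulVec x‖ ≤ hl * ‖x‖)
    (w : MvPolynomial (Fin 2) ℝ) (S : ℝ)
    (hS : ∀ v : Fin 2 → MvPolynomial (Fin 2) ℝ, (∀ i, (v i).totalDegree ≤ p) →
      |B.det| * (trefB (aff B b w) (aff B b (divP v))) ^ 2 ≤ S ^ 2 *
        (trefB (aff B b (v 0)) (aff B b (v 0)) + trefB (aff B b (v 1)) (aff B b (v 1)))) (i : Fin n) :
    |B.det| * (trefB (aff B b w) (pderiv 0 (u i))) ^ 2 ≤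
      2 * hl ^ 2 * S ^ 2 * trefB (u i) (u i) := by
  set q := aff B⁻¹ (-(B⁻¹.mulVec b)) (u i) with hq
  have hqu : aff B b q = u i := aff_inv B b hB _
  have hqd : q.totalDegree ≤ p := (totalDegree_aff_le _ _ _).trans (hu i)
  have key := hS (fun k => B k 0 • q) (fun k => (totalDegree_smul_le _ _).trans hqd)
  have hdiv : aff B b (divP (fun k => B k 0 • q)) = pderiv 0 (u i) := by
    rw [← hqu, pderiv_aff]
    simp [divP, smul_eq_C_mul, aff]
  rw [hdiv] at key
  simp only [map_smul, hqu, LinearMap.smul_apply, smul_eq_mul] at key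
  refine key.trans ?_
  have e0 : (B 0 0) ^ 2 ≤ hl ^ 2 := sq_le_sq' (abs_le.mp (entry_le B hl h1 0 0)).1
    (abs_le.mp (entry_le B hl h1 0 0)).2
  have e1 : (B 1 0) ^ 2 ≤ hl ^ 2 := sq_le_sq' (abs_le.mp (entry_le B hl h1 1 0)).1
    (abs_le.mp (entry_le B hl h1 1 0)).2
  have hn : 0 ≤ S ^ 2 * trefB (u i) (u i) := mul_nonneg (sq_nonneg _) (trefB_nonneg _)
  nlinarith [mul_le_mul_of_nonneg_right e0 hn, mul_le_mul_of_nonneg_right e1 hn]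

/-- For `w ∈ P_p(T)` on a shape-regular triangle `T = F(T̂)` of
diameter `h_l` (with `F(x̂) = B x̂ + b`, `‖Bx‖ ≤ h_l ‖x‖`, `‖x‖ ≤ (ρ/h_l) ‖Bx‖`):
`‖w‖_{0,T} ≤ C ( h_l · sup_{v ∈ (P_p(T))², v≠0} |∫_T w div v| / ‖v‖_{0,T}
  + h_l^{1/2} ‖w‖_{0,∂T} )`, with `C = C(p, ρ)`. -/
theorem stmt11 (p : ℕ) (ρ : ℝ) (hρ : 0 < ρ) :
    ∃ C > 0, ∀ (B : Matrix (Fin 2) (Fin 2) ℝ) (b : Fin 2 → ℝ) (hl : ℝ),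
      IsUnit B.det → 0 < hl →
      (∀ x : Fin 2 → ℝ, ‖B.mulVec x‖ ≤ hl * ‖x‖) →
      (∀ x : Fin 2 → ℝ, ‖x‖ ≤ (ρ / hl) * ‖B.mulVec x‖) →
      ∀ w : MvPolynomial (Fin 2) ℝ, w.totalDegree ≤ p →
      Real.sqrt (∫ x in (fun y => B.mulVec y + b) '' Tref, (eval x w) ^ 2) ≤
        C * (hl * sSup {r : ℝ | ∃ v : Fin 2 → MvPolynomial (Fin 2) ℝ,
              (∀ i, (v i).totalDegree ≤ p) ∧ v ≠ 0 ∧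
              r = |∫ x in (fun y => B.mulVec y + b) '' Tref,
                    eval x w * eval x (divP v)| /
                Real.sqrt (∫ x in (fun y => B.mulVec y + b) '' Tref,
                    ((eval x (v 0)) ^ 2 + (eval x (v 1)) ^ 2))} +
            Real.sqrt hl *
              Real.sqrt (edgeSq w b (B.mulVec (Pi.single 0 1) + b) +
                edgeSq w (B.mulVec (Pi.single 0 1) + b) (B.mulVec (Pi.single 1 1) + b) +
                edgeSq w (B.mulVec (Pi.single 1 1) + b) b)) := by
  obtain ⟨n, u, K, hK, hu, href⟩ := ref_est p
  set M := ∑ i, trefB (u i) (u i) with hM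
  have hM0 : 0 ≤ M := Finset.sum_nonneg fun i _ => trefB_nonneg _
  refine ⟨Real.sqrt (K * (2 * M + 2 * ρ)), Real.sqrt_pos.mpr (by positivity), ?_⟩
  intro B b hl hB hl0 h1 h2 w hw
  set S := sSup {r : ℝ | ∃ v : Fin 2 → MvPolynomial (Fin 2) ℝ,
              (∀ i, (v i).totalDegree ≤ p) ∧ v ≠ 0 ∧
              r = |∫ x in (fun y => B.mulVec y + b) '' Tref,
                    eval x w * eval x (divP v)| /
                Real.sqrt (∫ x in (fun y => B.mulVec y + b) '' Tref,
                    ((eval x (v 0)) ^ 2 + (eval x (v 1)) ^ 2))} with hS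
  obtain ⟨hS0, hSv⟩ := sup_bound p B b hB w S hS
  set E := edgeSq w b (B.mulVec (Pi.single 0 1) + b) +
                edgeSq w (B.mulVec (Pi.single 0 1) + b) (B.mulVec (Pi.single 1 1) + b) +
                edgeSq w (B.mulVec (Pi.single 1 1) + b) b with hE
  have hEd : hl * (edgeI (aff B b w) (Pi.single 0 1) (Pi.single 1 1) +
      edgeI (aff B b w) (Pi.single 1 1) 0) ≤ ρ * E := by
    have a1 := edge_low B b hl ρ hρ hl0 h2 w (Pi.single 0 1) (Pi.single 1 1) (by
      have := norm_le_pi_norm ((Pi.single 1 1 : Fin 2 → ℝ) - Pi.single 0 1) 1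
      simpa using this)
    have a2 := edge_low B b hl ρ hρ hl0 h2 w (Pi.single 1 1) 0 (by
      have := norm_le_pi_norm ((0 : Fin 2 → ℝ) - Pi.single 1 1) 1
      simpa using this)
    rw [Matrix.mulVec_zero, zero_add] at a2
    have a3 : 0 ≤ edgeSq w b (B.mulVec (Pi.single 0 1) + b) :=
      mul_nonneg (norm_nonneg _) (edgeI_nonneg _ _ _)
    rw [hE]
    nlinarith [mul_nonneg hρ.le a3]
  set Eh := edgeI (aff B b w) (Pi.single 0 1) (Pi.single 1 1) +
      edgeI (aff B b w) (Pi.single 1 1) 0 with hEh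
  have hEh0 : 0 ≤ Eh := add_nonneg (edgeI_nonneg _ _ _) (edgeI_nonneg _ _ _)
  have hE0 : 0 ≤ E := by
    have : 0 ≤ ρ * E := (mul_nonneg hl0.le hEh0).trans hEd
    exact nonneg_of_mul_nonneg_right this hρ
  have hdet : |B.det| ≤ 2 * hl ^ 2 := by
    rw [Matrix.det_fin_two]
    refine (abs_sub _ _).trans ?_
    rw [abs_mul, abs_mul]
    have e := entry_le B hl h1
    have := mul_le_mul (e 0 0) (e 1 1) (abs_nonneg _) hl0.le
    have := mul_le_mul (e 0 1) (e 1 0) (abs_nonneg _) hl0.le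
    linarith
  have hsum : |B.det| * ∑ i, (trefB (aff B b w) (pderiv 0 (u i))) ^ 2 ≤
      2 * hl ^ 2 * S ^ 2 * M := by
    rw [hM, Finset.mul_sum, Finset.mul_sum]
    exact Finset.sum_le_sum fun i _ => main_est p n u hu B b hB hl h1 w S hSv i
  have hEE : |B.det| * Eh ≤ 2 * ρ * (hl * E) := by
    calc |B.det| * Eh ≤ 2 * hl ^ 2 * Eh := mul_le_mul_of_nonneg_right hdet hEh0
      _ = 2 * hl * (hl * Eh) := by ring
      _ ≤ 2 * hl * (ρ * E) := mul_le_mul_of_nonneg_left hEd (by positivity)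
      _ = _ := by ring
  have hfin : |B.det| * trefB (aff B b w) (aff B b w) ≤
      K * (2 * M * (hl * S) ^ 2 + 2 * ρ * (hl * E)) := by
    calc |B.det| * trefB (aff B b w) (aff B b w)
        ≤ |B.det| * (K * (∑ i, (trefB (aff B b w) (pderiv 0 (u i))) ^ 2 + Eh)) :=
          mul_le_mul_of_nonneg_left (href _ ((totalDegree_aff_le _ _ _).trans hw)) (abs_nonneg _)
      _ = K * (|B.det| * ∑ i, (trefB (aff B b w) (pderiv 0 (u i))) ^ 2 + |B.det| * Eh) := by ring
      _ ≤ K * (2 * hl ^ 2 * S ^ 2 * M + 2 * ρ * (hl * E)) :=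
          mul_le_mul_of_nonneg_left (add_le_add hsum hEE) hK.le
      _ = _ := by ring
  have hr0 : 0 ≤ hl * S + Real.sqrt hl * Real.sqrt E := by positivity
  rw [int_S B b hB]
  rw [← Real.sqrt_sq hr0, ← Real.sqrt_mul (by positivity)]
  apply Real.sqrt_le_sqrt
  refine hfin.trans ?_
  rw [mul_assoc K]
  refine mul_le_mul_of_nonneg_left ?_ hK.le
  have hx : (Real.sqrt hl * Real.sqrt E) ^ 2 = hl * E := by
    rw [mul_pow, Real.sq_sqrt hl0.le, Real.sq_sqrt hE0]
  rw [← hx]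
  have p1 : 0 ≤ hl * S := by positivity
  have p2 : 0 ≤ Real.sqrt hl * Real.sqrt E := by positivity
  generalize hl * S = x at *
  generalize Real.sqrt hl * Real.sqrt E = y at *
  have t1 : x ^ 2 ≤ (x + y) ^ 2 := by nlinarith
  have t2 : y ^ 2 ≤ (x + y) ^ 2 := by nlinarith
  nlinarith [mul_le_mul_of_nonneg_left t1 hM0, mul_le_mul_of_nonneg_left t2 hρ.le]

end
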